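/- There exists a minimizer of the phase space uncertainty functional L_P over the domain D_P; that is, there exists f₀ ∈ D_P such that L_P(f₀) ≤ L_P(f) for all f ∈ D_P. -/

import Mathlib

open MeasureTheory Set Filter Topology
open scoped ENNReal Topology

noncomputable section

/-- `f` lies in the domain `D_P` of the phase space uncertainty, with `g` its
(a.e.) derivative: `f ∈ L²((0,∞))`, absolutely continuous on every compact
interval (encoded by `f x = ∫₀ˣ g`), `‖f‖_{L²} = 1`, zero expected time and
zero expected scale, and the functions `f'`, `√ω·f'`, `f/ω` and `ln(ω)·f` all
lie in `L²((0,∞))`. -/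
def InDP (f g : ℝ → ℂ) : Prop :=
  MemLp f 2 (volume : Measure ℝ) ∧
  (∀ x : ℝ, x ≤ 0 → f x = 0) ∧
  (∀ x : ℝ, IntervalIntegrable g volume 0 x) ∧
  (∀ x : ℝ, f x = ∫ t in (0:ℝ)..x, g t) ∧
  (∫ ω in Set.Ioi (0:ℝ), ‖f ω‖ ^ 2 = 1) ∧
  (∫ ω in Set.Ioi (0:ℝ), Complex.I * g ω * (starRingEnd ℂ) (f ω) = 0) ∧
  (∫ ω in Set.Ioi (0:ℝ), Real.log ω * ‖f ω‖ ^ 2 = 0) ∧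
  MemLp g 2 (volume.restrict (Set.Ioi (0:ℝ))) ∧
  MemLp (fun ω : ℝ => (Real.sqrt ω : ℂ) * g ω) 2 (volume.restrict (Set.Ioi (0:ℝ))) ∧
  MemLp (fun ω : ℝ => f ω / (ω : ℂ)) 2 (volume.restrict (Set.Ioi (0:ℝ))) ∧
  MemLp (fun ω : ℝ => (Real.log ω : ℂ) * f ω) 2 (volume.restrict (Set.Ioi (0:ℝ)))

/-- The squared window-space norm `W = ∫₀^∞ |f(ω)|²/ω dω`. -/
def Wnorm (f : ℝ → ℂ) : ℝ := ∫ ω in Set.Ioi (0:ℝ), ‖f ω‖ ^ 2 / ω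

/-- The (pulled-back) phase space uncertainty `L_P` of `f ∈ D_P`, expressed via
the derivative `g` of `f`:
`L_P(f) = ‖T_x f‖² + ‖T_σ f‖² + (1/W)·‖ω f'‖_W²·‖f/ω‖² + v_f^W(−ln ω)/W`. -/
def LP (f g : ℝ → ℂ) : ℝ :=
  (∫ ω in Set.Ioi (0:ℝ), ‖g ω‖ ^ 2) +
  (∫ ω in Set.Ioi (0:ℝ), (Real.log ω) ^ 2 * ‖f ω‖ ^ 2) +
  (1 / Wnorm f) * ((∫ ω in Set.Ioi (0:ℝ), ω * ‖g ω‖ ^ 2) *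
    (∫ ω in Set.Ioi (0:ℝ), ‖f ω‖ ^ 2 / ω ^ 2)) +
  ((1 / Wnorm f) * (∫ ω in Set.Ioi (0:ℝ), (Real.log ω) ^ 2 * ‖f ω‖ ^ 2 / ω) -
    (1 / Wnorm f ^ 2) * (∫ ω in Set.Ioi (0:ℝ), Real.log ω * ‖f ω‖ ^ 2 / ω) ^ 2)

lemma weak_subseq (μ : Measure ℝ) [SigmaFinite μ] (G : ℕ → ℝ → ℂ) (hG : ∀ n, MemLp (G n) 2 μ) (C : ℝ)
    (hC : ∀ n, ∫ x, ‖G n x‖ ^ 2 ∂μ ≤ C) :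
    ∃ G₀ : ℝ → ℂ, MemLp G₀ 2 μ ∧ ∃ φ : ℕ → ℕ, StrictMono φ ∧ ∀ h : ℝ → ℂ, MemLp h 2 μ →
      Tendsto (fun n => ∫ x, G (φ n) x * (starRingEnd ℂ) (h x) ∂μ) atTop
        (𝓝 (∫ x, G₀ x * (starRingEnd ℂ) (h x) ∂μ)) := by
  have : Fact ((2:ℝ≥0∞) ≠ ∞) := ⟨by norm_num⟩
  have : TopologicalSpace.SeparableSpace (Lp ℂ 2 μ) := inferInstance
  have key : ∀ u v : ℝ → ℂ, ∀ (hu : MemLp u 2 μ) (hv : MemLp v 2 μ),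
      inner ℂ (hu.toLp u) (hv.toLp v) = ∫ x, v x * (starRingEnd ℂ) (u x) ∂μ := by
    intro u v hu hv
    rw [L2.inner_def]
    apply integral_congr_ae
    filter_upwards [hu.coeFn_toLp, hv.coeFn_toLp] with x h1 h2
    rw [h1, h2]
    simp [RCLike.inner_apply]
  let Φ := InnerProductSpace.toDual ℂ (Lp ℂ 2 μ)
  have hb : ∀ n, StrongDual.toWeakDual (Φ ((hG n).toLp (G n))) ∈
      WeakDual.toStrongDual ⁻¹' Metric.closedBall (0 : StrongDual ℂ (Lp ℂ 2 μ)) (Real.sqrt C) := by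
    intro n
    simp only [mem_preimage, Metric.mem_closedBall, dist_zero_right]
    change ‖Φ ((hG n).toLp (G n))‖ ≤ _
    rw [LinearIsometryEquiv.norm_map]
    apply Real.le_sqrt_of_sq_le
    have := inner_self_eq_norm_sq_to_K (𝕜 := ℂ) ((hG n).toLp (G n))
    rw [key] at this
    refine le_trans (le_of_eq ?_) (hC n)
    have h2 : ∫ x, G n x * (starRingEnd ℂ) (G n x) ∂μ = ((∫ x, ‖G n x‖ ^ 2 ∂μ : ℝ) : ℂ) := by
      rw [← integral_complex_ofReal]
      congr 1; ext x
      rw [Complex.mul_conj, Complex.normSq_eq_norm_sq]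
    rw [h2] at this
    apply Complex.ofReal_injective
    push_cast
    exact this.symm
  obtain ⟨a, ha, φ, hφ, hlim⟩ := WeakDual.isSeqCompact_closedBall ℂ (Lp ℂ 2 μ) 0 (Real.sqrt C) hb
  refine ⟨Φ.symm (WeakDual.toStrongDual a), Lp.memLp _, φ, hφ, ?_⟩
  intro h hh
  have h1 := ((WeakBilin.eval_continuous _ (hh.toLp h)).tendsto a).comp hlim
  have h3 := (Complex.continuous_conj.tendsto _).comp h1
  have e1 : ∀ n, (starRingEnd ℂ) (Φ ((hG n).toLp (G n)) (hh.toLp h)) = ∫ x, G n x * (starRingEnd ℂ) (h x) ∂μ := by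
    intro n
    rw [← key _ _ hh (hG n), ← inner_conj_symm (hh.toLp h)]
    rfl
  have e2 : (starRingEnd ℂ) (a (hh.toLp h)) = ∫ x, (Φ.symm (WeakDual.toStrongDual a)) x * (starRingEnd ℂ) (h x) ∂μ := by
    rw [← key _ _ hh (Lp.memLp _), Lp.toLp_coeFn, ← inner_conj_symm, InnerProductSpace.toDual_symm_apply]
    rfl
  rw [← e2]
  refine h3.congr ?_
  intro n
  rw [← e1]
  rfl
lemma fatou_real {μ : Measure ℝ} (u : ℕ → ℝ → ℝ) (v : ℝ → ℝ) (a : ℕ → ℝ) (L : ℝ)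
    (hu : ∀ n, Integrable (u n) μ) (h0 : ∀ n, ∀ᵐ x ∂μ, 0 ≤ u n x)
    (hlim : ∀ᵐ x ∂μ, Tendsto (fun n => u n x) atTop (𝓝 (v x)))
    (ha : ∀ n, ∫ x, u n x ∂μ ≤ a n) (hL : Tendsto a atTop (𝓝 L)) :
    Integrable v μ ∧ ∫ x, v x ∂μ ≤ L := by
  have hm : AEStronglyMeasurable v μ :=
    aestronglyMeasurable_of_tendsto_ae atTop (fun n => (hu n).aestronglyMeasurable) hlim
  have hv0 : ∀ᵐ x ∂μ, 0 ≤ v x := by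
    filter_upwards [hlim, ae_all_iff.2 h0] with x hx h
    exact ge_of_tendsto' hx h
  have hL0 : 0 ≤ L := ge_of_tendsto' hL (fun n => (integral_nonneg_of_ae (h0 n)).trans (ha n))
  have key : ∫⁻ x, ENNReal.ofReal (v x) ∂μ ≤ ENNReal.ofReal L := by
    calc ∫⁻ x, ENNReal.ofReal (v x) ∂μ
        = ∫⁻ x, liminf (fun n => ENNReal.ofReal (u n x)) atTop ∂μ := by
          apply lintegral_congr_ae
          filter_upwards [hlim] with x hx
          exact ((ENNReal.tendsto_ofReal hx).liminf_eq).symm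
      _ ≤ liminf (fun n => ∫⁻ x, ENNReal.ofReal (u n x) ∂μ) atTop :=
          lintegral_liminf_le' (fun n => (hu n).aestronglyMeasurable.aemeasurable.ennreal_ofReal)
      _ ≤ liminf (fun n => ENNReal.ofReal (a n)) atTop := by
          refine liminf_le_liminf (Eventually.of_forall (fun n => ?_))
          rw [← ofReal_integral_eq_lintegral_ofReal (hu n) (h0 n)]
          exact ENNReal.ofReal_le_ofReal (ha n)
      _ = ENNReal.ofReal L := (ENNReal.tendsto_ofReal hL).liminf_eq
  have hIntg : Integrable v μ := by
    refine ⟨hm, ?_⟩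
    rw [hasFiniteIntegral_iff_ofReal hv0]
    exact key.trans_lt ENNReal.ofReal_lt_top
  refine ⟨hIntg, ?_⟩
  rw [← ofReal_integral_eq_lintegral_ofReal hIntg hv0] at key
  exact (ENNReal.ofReal_le_ofReal_iff hL0).1 key

def GoodW (w : ℝ → ℝ) : Prop :=
  Measurable w ∧ (∀ R : ℝ, IntegrableOn (fun x => w x * x) (Ioc 0 R)) ∧
    ∀ ε > 0, ∃ R > 0, ∀ x > R, |w x| ≤ ε * (Real.log x) ^ 2

lemma good_integrable {w u : ℝ → ℝ} (hw : GoodW w) {K : ℝ}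
    (hm : AEStronglyMeasurable u (volume.restrict (Ioi 0)))
    (hu0 : ∀ x > 0, 0 ≤ u x) (huK : ∀ x > 0, u x ≤ K * x)
    (hlog : IntegrableOn (fun x => (Real.log x) ^ 2 * u x) (Ioi 0)) :
    IntegrableOn (fun x => w x * u x) (Ioi 0) := by
  obtain ⟨hwm, hwi, hwt⟩ := hw
  obtain ⟨R, hR0, hR⟩ := hwt 1 one_pos
  have h1 : IntegrableOn (fun x => w x * u x) (Ioc 0 R) := by
    refine Integrable.mono ((hwi R).const_mul K) ?_ ?_
    · exact (hwm.aestronglyMeasurable.mul (hm.mono_measure (Measure.restrict_mono Ioc_subset_Ioi_self le_rfl)))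
    · filter_upwards [ae_restrict_mem measurableSet_Ioc] with x hx
      have := hu0 x hx.1
      have h2 := huK x hx.1
      rw [show K * (w x * x) = w x * (K * x) by ring, norm_mul, norm_mul]
      apply mul_le_mul_of_nonneg_left _ (norm_nonneg _)
      rw [Real.norm_of_nonneg this, Real.norm_of_nonneg (this.trans h2)]
      exact h2
  have h2 : IntegrableOn (fun x => w x * u x) (Ioi R) := by
    have hs : Ioi R ⊆ Ioi (0:ℝ) := Ioi_subset_Ioi hR0.le
    refine Integrable.mono (hlog.mono_set hs) ?_ ?_
    · exact (hwm.aestronglyMeasurable.mul (hm.mono_measure (Measure.restrict_mono hs le_rfl)))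
    · filter_upwards [ae_restrict_mem measurableSet_Ioi] with x hx
      have h3 := hR x hx
      rw [norm_mul, norm_mul]
      apply mul_le_mul_of_nonneg_right _ (norm_nonneg _)
      rw [Real.norm_eq_abs, Real.norm_of_nonneg (sq_nonneg _)]
      linarith
  rw [← Ioc_union_Ioi_eq_Ioi hR0.le]
  exact h1.union h2

/-- Tight convergence to zero. -/
lemma good_tendsto_zero {w : ℝ → ℝ} (hw : GoodW w) {K C : ℝ} (v : ℕ → ℝ → ℝ)
    (hm : ∀ n, AEStronglyMeasurable (v n) (volume.restrict (Ioi 0)))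
    (hv0 : ∀ n, ∀ x > 0, 0 ≤ v n x) (hvK : ∀ n, ∀ x > 0, v n x ≤ K * x)
    (hlog : ∀ n, IntegrableOn (fun x => (Real.log x) ^ 2 * v n x) (Ioi 0))
    (hC : ∀ n, ∫ x in Ioi 0, (Real.log x) ^ 2 * v n x ≤ C)
    (hlim : ∀ x > 0, Tendsto (fun n => v n x) atTop (𝓝 0)) :
    Tendsto (fun n => ∫ x in Ioi 0, |w x| * v n x) atTop (𝓝 0) := by
  have hw' : GoodW (fun x => |w x|) := by
    obtain ⟨a, b, c⟩ := hw
    refine ⟨a.norm, fun R => ?_, ?_⟩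
    · refine ((b R).norm).congr ?_
      filter_upwards [ae_restrict_mem measurableSet_Ioc] with x hx
      simp [abs_of_pos hx.1]
    · simpa using c
  have hIntg : ∀ n, IntegrableOn (fun x => |w x| * v n x) (Ioi 0) := fun n =>
    good_integrable hw' (hm n) (hv0 n) (hvK n) (hlog n)
  have hC0 : 0 ≤ C := le_trans (setIntegral_nonneg measurableSet_Ioi
    (fun x hx => mul_nonneg (sq_nonneg _) (hv0 0 x hx))) (hC 0)
  rw [Metric.tendsto_atTop]
  intro ε hε
  have hδ : 0 < ε / (2 * (C + 1)) := by positivity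
  obtain ⟨R, hR0, hR⟩ := hw.2.2 _ hδ
  have h1 : Tendsto (fun n => ∫ x in Ioc 0 R, |w x| * v n x) atTop (𝓝 (∫ x in Ioc (0:ℝ) R, (0:ℝ))) := by
    apply tendsto_integral_of_dominated_convergence (fun x => K * (|w x| * x))
    · intro n
      exact ((hIntg n).mono_set Ioc_subset_Ioi_self).aestronglyMeasurable
    · exact (hw'.2.1 R).const_mul K
    · intro n
      filter_upwards [ae_restrict_mem measurableSet_Ioc] with x hx
      rw [Real.norm_of_nonneg (mul_nonneg (abs_nonneg _) (hv0 n x hx.1))]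
      rw [show K * (|w x| * x) = |w x| * (K * x) by ring]
      exact mul_le_mul_of_nonneg_left (hvK n x hx.1) (abs_nonneg _)
    · filter_upwards [ae_restrict_mem measurableSet_Ioc] with x hx
      simpa using (hlim x hx.1).const_mul (|w x|)
  rw [integral_zero, Metric.tendsto_atTop] at h1
  obtain ⟨N, hN⟩ := h1 (ε / 2) (half_pos hε)
  refine ⟨N, fun n hn => ?_⟩
  have h2 := hN n hn
  have hnn : ∀ s ⊆ Ioi (0:ℝ), MeasurableSet s → 0 ≤ ∫ x in s, |w x| * v n x := fun s hs hsm =>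
    setIntegral_nonneg hsm (fun x hx => mul_nonneg (abs_nonneg _) (hv0 n x (hs hx)))
  rw [Real.dist_eq, sub_zero] at h2 ⊢
  rw [abs_of_nonneg (hnn _ Ioc_subset_Ioi_self measurableSet_Ioc)] at h2
  rw [abs_of_nonneg (hnn _ subset_rfl measurableSet_Ioi)]
  have hs : Ioi R ⊆ Ioi (0:ℝ) := Ioi_subset_Ioi hR0.le
  have hsplit : ∫ x in Ioi 0, |w x| * v n x =
      (∫ x in Ioc 0 R, |w x| * v n x) + ∫ x in Ioi R, |w x| * v n x := by
    rw [← Ioc_union_Ioi_eq_Ioi hR0.le]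
    exact setIntegral_union (Ioc_disjoint_Ioi le_rfl) measurableSet_Ioi
      ((hIntg n).mono_set Ioc_subset_Ioi_self) ((hIntg n).mono_set hs)
  have h3 : ∫ x in Ioi R, |w x| * v n x ≤ ε / (2 * (C + 1)) * C := by
    calc ∫ x in Ioi R, |w x| * v n x
        ≤ ∫ x in Ioi R, ε / (2 * (C + 1)) * ((Real.log x) ^ 2 * v n x) := by
          apply setIntegral_mono_on ((hIntg n).mono_set hs) (((hlog n).mono_set hs).const_mul _) measurableSet_Ioi
          intro x hx
          rw [← mul_assoc]
          exact mul_le_mul_of_nonneg_right (hR x hx) (hv0 n x (hs hx))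
      _ = ε / (2 * (C + 1)) * ∫ x in Ioi R, ((Real.log x) ^ 2 * v n x) := integral_const_mul _ _
      _ ≤ ε / (2 * (C + 1)) * C := by
          apply mul_le_mul_of_nonneg_left _ hδ.le
          refine le_trans (setIntegral_mono_set (hlog n) ?_ hs.eventuallyLE) (hC n)
          filter_upwards [ae_restrict_mem measurableSet_Ioi] with x hx
          exact mul_nonneg (sq_nonneg _) (hv0 n x hx)
  have h4 : ε / (2 * (C + 1)) * C < ε / 2 := by
    rw [div_mul_eq_mul_div, div_lt_div_iff₀ (by positivity) (by positivity)]
    nlinarith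
  linarith

lemma good_tendsto {w : ℝ → ℝ} (hw : GoodW w) {K C : ℝ} (u : ℕ → ℝ → ℝ) (u₀ : ℝ → ℝ)
    (hm : ∀ n, AEStronglyMeasurable (u n) (volume.restrict (Ioi 0)))
    (hv0 : ∀ n, ∀ x > 0, 0 ≤ u n x) (hvK : ∀ n, ∀ x > 0, u n x ≤ K * x)
    (hlog : ∀ n, IntegrableOn (fun x => (Real.log x) ^ 2 * u n x) (Ioi 0))
    (hC : ∀ n, ∫ x in Ioi 0, (Real.log x) ^ 2 * u n x ≤ C)
    (hlim : ∀ x > 0, Tendsto (fun n => u n x) atTop (𝓝 (u₀ x))) :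
    Tendsto (fun n => ∫ x in Ioi 0, w x * u n x) atTop (𝓝 (∫ x in Ioi 0, w x * u₀ x)) := by
  have hlim' : ∀ᵐ x ∂(volume.restrict (Ioi (0:ℝ))), Tendsto (fun n => u n x) atTop (𝓝 (u₀ x)) := by
    filter_upwards [ae_restrict_mem measurableSet_Ioi] with x hx using hlim x hx
  have hm0 : AEStronglyMeasurable u₀ (volume.restrict (Ioi 0)) :=
    aestronglyMeasurable_of_tendsto_ae atTop hm hlim'
  have h00 : ∀ x > 0, 0 ≤ u₀ x := fun x hx => ge_of_tendsto' (hlim x hx) (fun n => hv0 n x hx)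
  have h0K : ∀ x > 0, u₀ x ≤ K * x := fun x hx => le_of_tendsto' (hlim x hx) (fun n => hvK n x hx)
  obtain ⟨hl0, hC0⟩ := fatou_real (μ := volume.restrict (Ioi 0)) (fun n x => (Real.log x) ^ 2 * u n x)
    (fun x => (Real.log x) ^ 2 * u₀ x) (fun _ => C) C hlog (by
      intro n
      filter_upwards [ae_restrict_mem measurableSet_Ioi] with x hx
      exact mul_nonneg (sq_nonneg _) (hv0 n x hx)) (by
      filter_upwards [hlim'] with x hx using hx.const_mul _) hC tendsto_const_nhds
  have hI : ∀ n, IntegrableOn (fun x => w x * u n x) (Ioi 0) := fun n =>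
    good_integrable hw (hm n) (hv0 n) (hvK n) (hlog n)
  have hI0 : IntegrableOn (fun x => w x * u₀ x) (Ioi 0) := good_integrable hw hm0 h00 h0K hl0
  have hdl : ∀ n, IntegrableOn (fun x => (Real.log x) ^ 2 * |u n x - u₀ x|) (Ioi 0) := by
    intro n
    refine (((hlog n).sub hl0).norm).congr (Eventually.of_forall fun x => ?_)
    simp only [Pi.sub_apply, Real.norm_eq_abs]
    rw [← mul_sub, abs_mul, abs_of_nonneg (sq_nonneg (Real.log x))]
  have key := good_tendsto_zero hw (K := K) (C := C + C) (fun n x => |u n x - u₀ x|)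
    (fun n => ((hm n).sub hm0).norm) (fun n x hx => abs_nonneg _) (by
      intro n x hx
      have := hv0 n x hx
      have := hvK n x hx
      have := h00 x hx
      have := h0K x hx
      rw [abs_le]; constructor <;> linarith) hdl (by
      intro n
      refine le_trans ?_ (add_le_add (hC n) hC0)
      rw [← integral_add (hlog n) hl0]
      apply setIntegral_mono_on (hdl n) ((hlog n).add hl0) measurableSet_Ioi
      intro x hx
      simp only [Pi.add_apply]
      rw [← mul_add]
      apply mul_le_mul_of_nonneg_left _ (sq_nonneg _)
      have := hv0 n x hx
      have := h00 x hx
      rw [abs_le]; constructor <;> linarith) (by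
      intro x hx
      have := ((hlim x hx).sub_const (u₀ x)).abs
      simpa using this)
  rw [tendsto_iff_norm_sub_tendsto_zero]
  refine squeeze_zero (fun _ => norm_nonneg _) (fun n => ?_) key
  rw [← integral_sub (hI n) hI0]
  refine (norm_integral_le_integral_norm _).trans (le_of_eq ?_)
  congr 1; ext x
  rw [← mul_sub, norm_mul]; rfl

lemma good_of (w : ℝ → ℝ) (hm : Measurable w) (h : ∀ R : ℝ, IntegrableOn (fun x => w x * x) (Ioc 0 R))
    (ht : ∀ ε > 0, ∀ x, 1 ≤ x → 1/ε ≤ x → 1 ≤ Real.log x → 1 ≤ ε * Real.log x →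
      |w x| ≤ ε * (Real.log x) ^ 2) : GoodW w := by
  refine ⟨hm, h, fun ε hε => ⟨Real.exp (max 1 (1/ε)), Real.exp_pos _, fun x hx => ?_⟩⟩
  have hx0 : 0 < x := (Real.exp_pos _).trans hx
  have h1 : max 1 (1/ε) < Real.log x := (Real.lt_log_iff_exp_lt hx0).2 hx
  have h2 : max 1 (1/ε) + 1 ≤ Real.exp (max 1 (1/ε)) := Real.add_one_le_exp _
  have h3 := le_max_left 1 (1/ε)
  have h4 := le_max_right 1 (1/ε)
  refine ht ε hε x (by linarith) (by linarith) (by linarith) ?_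
  have : 1/ε ≤ Real.log x := by linarith
  rw [div_le_iff₀ hε] at this
  linarith

lemma log_sq_integrableOn (R : ℝ) : IntegrableOn (fun x => Real.log x ^ 2) (Ioc 0 R) := by
  have h1 : IntegrableOn (fun x : ℝ => 16 * x ^ (-(1/2):ℝ) + x ^ 2) (Ioc 0 R) := by
    rcases le_or_gt R 0 with h | h
    · simp [Ioc_eq_empty (not_lt.2 h)]
    refine Integrable.add (Integrable.const_mul ?_ _) ?_
    · exact (intervalIntegrable_iff_integrableOn_Ioc_of_le h.le).1
        (intervalIntegral.intervalIntegrable_rpow' (by norm_num))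
    · exact (continuous_pow 2).integrableOn_Ioc
  refine Integrable.mono h1 (Real.measurable_log.pow_const 2).aestronglyMeasurable ?_
  filter_upwards [ae_restrict_mem measurableSet_Ioc] with x hx
  have hx0 := hx.1
  have hp := Real.rpow_pos_of_pos hx0 (-(1/2):ℝ)
  rw [Real.norm_of_nonneg (sq_nonneg _), Real.norm_of_nonneg (by positivity)]
  rcases le_total x 1 with h | h
  · have h2 := (Real.abs_log_mul_self_rpow_lt x (1/4) hx0 h (by norm_num)).le
    have h3 : (Real.log x * x ^ (1/4:ℝ)) ^ 2 ≤ 16 := by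
      rw [← sq_abs]
      calc _ ≤ (1 / (1/4) : ℝ) ^ 2 := by gcongr
        _ = 16 := by norm_num
    have h4 : Real.log x ^ 2 = (Real.log x * x ^ (1/4:ℝ)) ^ 2 * x ^ (-(1/2):ℝ) := by
      rw [mul_pow, ← Real.rpow_natCast (x ^ (1/4:ℝ)), ← Real.rpow_mul hx0.le, mul_assoc,
        ← Real.rpow_add hx0]
      norm_num
    rw [h4]
    nlinarith
  · have := Real.log_nonneg h
    have := Real.log_le_self hx0.le
    nlinarith

lemma good_one : GoodW (fun _ => 1) := by
  refine good_of _ measurable_const (fun R => ?_) ?_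
  · exact (by fun_prop : Continuous fun x : ℝ => (1:ℝ) * x).integrableOn_Ioc
  · intro ε hε x h1 h2 h3 h4
    simp only [abs_one]; nlinarith

lemma good_log : GoodW Real.log := by
  refine good_of _ Real.measurable_log (fun R => ?_) ?_
  · have := Real.continuous_mul_log.integrableOn_Ioc (μ := volume) (a := 0) (b := R)
    refine this.congr_fun (fun x _ => mul_comm _ _) measurableSet_Ioc
  · intro ε hε x h1 h2 h3 h4
    rw [abs_of_nonneg (by linarith)]; nlinarith

lemma good_inv : GoodW (fun x => 1 / x) := by
  refine good_of _ (by fun_prop) (fun R => ?_) ?_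
  · have := (continuous_const (X := ℝ) (y := (1:ℝ))).integrableOn_Ioc (μ := volume) (a := 0) (b := R)
    refine this.congr_fun (fun x hx => ?_) measurableSet_Ioc
    have := hx.1.ne'
    simp only; field_simp
  · intro ε hε x h1 h2 h3 h4
    rw [abs_of_nonneg (by positivity), div_le_iff₀ (by linarith)]
    have : 1 ≤ ε * Real.log x ^ 2 := by nlinarith
    nlinarith

lemma good_log_inv : GoodW (fun x => Real.log x / x) := by
  refine good_of _ (by fun_prop) (fun R => ?_) ?_
  · rcases le_or_gt R 0 with h | h
    · simp [Ioc_eq_empty (not_lt.2 h)]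
    have := (intervalIntegrable_iff_integrableOn_Ioc_of_le h.le).1
        (intervalIntegral.intervalIntegrable_log' (a := 0) (b := R))
    refine this.congr_fun (fun x hx => ?_) measurableSet_Ioc
    have := hx.1.ne'
    change Real.log x = Real.log x / x * x
    field_simp
  · intro ε hε x h1 h2 h3 h4
    rw [abs_of_nonneg (by positivity), div_le_iff₀ (by linarith)]
    have : Real.log x ≤ ε * Real.log x ^ 2 := by nlinarith
    nlinarith

lemma good_log2_inv : GoodW (fun x => Real.log x ^ 2 / x) := by
  refine good_of _ (by fun_prop) (fun R => ?_) ?_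
  · refine (log_sq_integrableOn R).congr_fun (fun x hx => ?_) measurableSet_Ioc
    have := hx.1.ne'
    simp only; field_simp
  · intro ε hε x h1 h2 h3 h4
    rw [abs_of_nonneg (by positivity), div_le_iff₀ (by linarith)]
    rw [div_le_iff₀ hε] at h2
    have : 0 ≤ Real.log x ^ 2 := sq_nonneg _
    nlinarith
lemma hcs_sq {φ : ℝ → ℝ} (h : HasCompactSupport φ) : HasCompactSupport (fun x => φ x ^ 2) := by
  refine h.mono (fun x hx => ?_)
  simpa using hx

lemma hcs_c {φ : ℝ → ℝ} (h : HasCompactSupport φ) : HasCompactSupport (fun x => (φ x : ℂ)) := by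
  refine h.mono (fun x hx => ?_)
  simpa using hx

lemma exists_bump : ∃ φ : ℝ → ℝ, ContDiff ℝ 1 φ ∧ HasCompactSupport φ ∧
    ∀ x, φ x ≠ 0 ↔ 1 < x ∧ x < 3 := by
  let φ : ContDiffBump (2:ℝ) := ⟨1/2, 1, by norm_num, by norm_num⟩
  refine ⟨φ, φ.contDiff, φ.hasCompactSupport, fun x => ?_⟩
  have h : φ x ≠ 0 ↔ x ∈ Function.support φ := Iff.rfl
  rw [h, φ.support_eq]
  simp only [Metric.mem_ball, Real.dist_eq, φ]
  rw [abs_lt]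
  constructor
  · rintro ⟨h1, h2⟩; constructor <;> linarith
  · rintro ⟨h1, h2⟩; constructor <;> linarith

lemma exists_InDP : ∃ f g : ℝ → ℂ, InDP f g := by
  obtain ⟨φ, hφd, hφcs, hφiff⟩ := exists_bump
  have hφs : ∀ x, φ x ≠ 0 → 1 < x ∧ x < 3 := fun x hx => (hφiff x).1 hx
  have hφc : Continuous φ := hφd.continuous
  have hlogint : Integrable (fun x => Real.log x * φ x ^ 2) (volume.restrict (Ioi 0)) := by
    have h2 : Integrable (fun x => φ x ^ 2) := by
      exact Continuous.integrable_of_hasCompactSupport (by fun_prop) (hcs_sq hφcs)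
    refine Integrable.mono' (h2.restrict.const_mul 3) ?_ (Eventually.of_forall fun x => ?_)
    · exact (Real.measurable_log.mul (hφc.measurable.pow_const 2)).aestronglyMeasurable
    · by_cases hx : φ x = 0
      · simp [hx]
      · obtain ⟨h1, h3⟩ := hφs x hx
        have := Real.log_nonneg h1.le
        have := Real.log_le_self (by linarith : 0 ≤ x)
        rw [norm_mul, Real.norm_of_nonneg (by assumption), Real.norm_of_nonneg (sq_nonneg _)]
        apply mul_le_mul_of_nonneg_right _ (sq_nonneg _)
        linarith
  have h2int : Integrable (fun x => φ x ^ 2) (volume.restrict (Ioi 0)) := by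
    exact Integrable.restrict (Continuous.integrable_of_hasCompactSupport (by fun_prop) (hcs_sq hφcs))
  set N := ∫ x in Ioi (0:ℝ), φ x ^ 2 with hN
  have hNpos : 0 < N := by
    rw [hN, integral_pos_iff_support_of_nonneg (fun x => sq_nonneg _) h2int]
    have : Ioo (1:ℝ) 3 ⊆ Function.support (fun x => φ x ^ 2) := by
      intro x hx
      have := (hφiff x).2 hx
      simpa using this
    refine lt_of_lt_of_le ?_ (measure_mono this)
    rw [Measure.restrict_apply measurableSet_Ioo, inter_eq_left.2 (fun x hx => by
      have := hx.1
      simp only [mem_Ioi]; linarith)]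
    simp
  set Λ := (∫ x in Ioi (0:ℝ), Real.log x * φ x ^ 2) / N with hΛ
  set a := Real.exp Λ with ha
  have ha0 : 0 < a := Real.exp_pos _
  set c := Real.sqrt (a / N) with hc
  have hc2 : c ^ 2 = a / N := Real.sq_sqrt (by positivity)
  let F : ℝ → ℝ := fun x => c * φ (a * x)
  have hFd : ContDiff ℝ 1 F := by
    fun_prop
  have hFs : ∀ x, F x ≠ 0 → 1 / a < x ∧ x < 3 / a := by
    intro x hx
    have : φ (a * x) ≠ 0 := fun h => hx (by simp [F, h])
    obtain ⟨h1, h2⟩ := hφs _ this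
    rw [div_lt_iff₀ ha0, lt_div_iff₀ ha0]
    constructor <;> linarith
  have hFcs : HasCompactSupport F := by
    refine HasCompactSupport.intro (isCompact_Icc (a := 1 / a) (b := 3 / a)) ?_
    intro x hx
    by_contra h
    exact hx ⟨(hFs x h).1.le, (hFs x h).2.le⟩
  have hFz : ∀ x ≤ 1 / a, F x = 0 := by
    intro x hx
    by_contra h
    linarith [(hFs x h).1]
  have hia : 0 < 1 / a := by positivity
  have hFc : Continuous F := hFd.continuous
  have hF'c : Continuous (deriv F) := hFd.continuous_deriv le_rfl
  have hF'cs : HasCompactSupport (deriv F) := hFcs.deriv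
  have hFder : ∀ x, HasDerivAt F (deriv F x) x := fun x =>
    (hFd.differentiable one_ne_zero x).hasDerivAt
  have hmf : MemLp (fun x => (F x : ℂ)) 2 (volume : Measure ℝ) :=
    (Complex.continuous_ofReal.comp hFc).memLp_of_hasCompactSupport
      (hcs_c hFcs)
  have hscale : ∀ w : ℝ → ℝ, ∫ x in Ioi (0:ℝ), w (a * x) * F x ^ 2 =
      N⁻¹ * ∫ x in Ioi (0:ℝ), w x * φ x ^ 2 := by
    intro w
    have := integral_comp_mul_left_Ioi (fun x => c ^ 2 * (w x * φ x ^ 2)) 0 ha0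
    rw [mul_zero, integral_const_mul, integral_const_mul, smul_eq_mul, hc2] at this
    have e : ∀ x, w (a * x) * F x ^ 2 = a / N * (w (a * x) * φ (a * x) ^ 2) := by
      intro x; simp only [F]; rw [mul_pow, hc2]; ring
    simp_rw [e]
    rw [integral_const_mul, this]
    field_simp
  have hFn : ∀ x, ‖(F x : ℂ)‖ ^ 2 = F x ^ 2 := by
    intro x; rw [Complex.norm_real, Real.norm_eq_abs, sq_abs]
  have hone : ∫ x in Ioi (0:ℝ), F x ^ 2 = 1 := by
    have := hscale (fun _ => 1)
    simp only [one_mul] at this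
    rw [this, ← hN, inv_mul_cancel₀ hNpos.ne']
  refine ⟨fun x => (F x : ℂ), fun x => ((deriv F x : ℝ) : ℂ), hmf, ?_, ?_, ?_, ?_, ?_, ?_, ?_, ?_, ?_, ?_⟩
  · intro x hx
    simp [hFz x (by linarith)]
  · intro x
    exact (Complex.continuous_ofReal.comp hF'c).intervalIntegrable _ _
  · intro x
    rw [intervalIntegral.integral_ofReal, intervalIntegral.integral_eq_sub_of_hasDerivAt (fun y _ => hFder y)
      (hF'c.intervalIntegrable _ _), hFz 0 hia.le, sub_zero]
  · simp_rw [hFn]; exact hone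
  · have h1 : HasCompactSupport (fun x => F x ^ 2) := hcs_sq hFcs
    have h2 := h1.integral_Ioi_deriv_eq (by fun_prop) 0
    have h3 : ∀ x, deriv (fun x => F x ^ 2) x = 2 * (deriv F x * F x) := by
      intro x
      have h := ((hFder x).fun_pow 2).deriv
      rw [h]; simp; ring
    simp_rw [h3] at h2
    rw [integral_const_mul, hFz 0 hia.le] at h2
    have h4 : ∫ x in Ioi (0:ℝ), deriv F x * F x = 0 := by
      norm_num at h2; exact h2
    have h5 : ∀ x, Complex.I * ((deriv F x : ℝ) : ℂ) * (starRingEnd ℂ) (F x : ℂ) =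
        Complex.I * ((deriv F x * F x : ℝ) : ℂ) := by
      intro x; rw [Complex.conj_ofReal]; push_cast; ring
    simp_rw [h5]
    rw [integral_const_mul, integral_complex_ofReal, h4]; simp
  · simp_rw [hFn]
    have h1 : ∫ x in Ioi (0:ℝ), Real.log x * F x ^ 2 =
        ∫ x in Ioi (0:ℝ), (Real.log (a * x) - Λ) * F x ^ 2 := by
      apply setIntegral_congr_fun measurableSet_Ioi
      intro x hx
      simp only
      rw [Real.log_mul ha0.ne' (ne_of_gt hx), ha, Real.log_exp]; ring
    rw [h1, hscale (fun y => Real.log y - Λ)]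
    simp_rw [sub_mul]
    rw [integral_sub hlogint (h2int.const_mul _), integral_const_mul, ← hN, hΛ]
    field_simp
    ring
  · exact ((Complex.continuous_ofReal.comp hF'c).memLp_of_hasCompactSupport
      (hcs_c hF'cs)).restrict _
  · refine MemLp.restrict _ ?_
    refine Continuous.memLp_of_hasCompactSupport (by fun_prop) ?_
    exact (hcs_c hF'cs).mul_left
  · refine MemLp.of_le_mul (c := a) (hmf.restrict _) ?_ (Eventually.of_forall fun x => ?_)
    · exact (Measurable.div (by fun_prop) (by fun_prop)).aestronglyMeasurable
    · by_cases hx : F x = 0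
      · simp [hx]
      · have h1 := (hFs x hx).1
        have hx0 : 0 < x := hia.trans h1
        rw [norm_div, Complex.norm_real x, Real.norm_of_nonneg hx0.le, div_eq_inv_mul]
        apply mul_le_mul_of_nonneg_right _ (norm_nonneg _)
        rw [inv_le_comm₀ hx0 ha0]
        simpa using h1.le
  · refine MemLp.of_le_mul (c := |Real.log (1/a)| + |Real.log (3/a)|) (hmf.restrict _) ?_
      (Eventually.of_forall fun x => ?_)
    · exact (Measurable.mul (by fun_prop) (by fun_prop)).aestronglyMeasurable
    · by_cases hx : F x = 0
      · simp [hx]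
      · obtain ⟨h1, h2⟩ := (hFs x hx)
        have hx0 : 0 < x := hia.trans h1
        rw [norm_mul, Complex.norm_real (Real.log x), Real.norm_eq_abs]
        apply mul_le_mul_of_nonneg_right _ (norm_nonneg _)
        have h3 := Real.log_le_log hia h1.le
        have h4 := Real.log_le_log hx0 h2.le
        rw [abs_le]
        constructor
        · linarith [neg_abs_le (Real.log (1/a)), abs_nonneg (Real.log (3/a))]
        · linarith [le_abs_self (Real.log (3/a)), abs_nonneg (Real.log (1/a))]
lemma f_bound {f g : ℝ → ℂ} (hfg : ∀ x, f x = ∫ t in (0:ℝ)..x, g t)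
    (hg : MemLp g 2 (volume.restrict (Ioi (0:ℝ)))) {C : ℝ}
    (hC : ∫ x in Ioi (0:ℝ), ‖g x‖ ^ 2 ≤ C) : ∀ x > 0, ‖f x‖ ^ 2 ≤ ((C + 1) / 2) ^ 2 * x := by
  intro x hx
  have hI : IntegrableOn (fun t => ‖g t‖ ^ 2) (Ioi 0) :=
    (memLp_two_iff_integrable_sq_norm hg.aestronglyMeasurable).1 hg
  have hgi : IntegrableOn g (Ioc 0 x) := by
    have : MemLp g 2 (volume.restrict (Ioc 0 x)) :=
      hg.mono_measure (Measure.restrict_mono Ioc_subset_Ioi_self le_rfl)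
    exact this.integrable (by norm_num)
  have hC0 : 0 ≤ C := le_trans (integral_nonneg (fun _ => sq_nonneg _)) hC
  have hs := Real.sq_sqrt hx.le
  have hs0 : 0 < Real.sqrt x := Real.sqrt_pos.2 hx
  have h1 : ‖f x‖ ≤ ∫ t in Ioc 0 x, ‖g t‖ := by
    rw [hfg x, intervalIntegral.integral_of_le hx.le]
    exact norm_integral_le_integral_norm _
  have h2 : 2 * Real.sqrt x * ∫ t in Ioc 0 x, ‖g t‖ ≤ ∫ t in Ioc 0 x, (x * ‖g t‖ ^ 2 + 1) := by
    rw [← integral_const_mul]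
    apply integral_mono (hgi.norm.const_mul _)
    · exact ((hI.mono_set Ioc_subset_Ioi_self).const_mul x).add (integrable_const _)
    · intro t
      simp only
      nlinarith [sq_nonneg (Real.sqrt x * ‖g t‖ - 1)]
  have h3 : ∫ t in Ioc 0 x, (x * ‖g t‖ ^ 2 + 1) ≤ x * C + x := by
    rw [integral_add ((hI.mono_set Ioc_subset_Ioi_self).const_mul x) (integrable_const _),
      integral_const_mul]
    have : ∫ t in Ioc 0 x, ‖g t‖ ^ 2 ≤ C :=
      (setIntegral_mono_set hI (Eventually.of_forall fun _ => sq_nonneg _)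
        Ioc_subset_Ioi_self.eventuallyLE).trans hC
    have h4 : ∫ _ in Ioc 0 x, (1:ℝ) = x := by simp [hx.le]
    rw [h4]
    nlinarith
  have h5 : 2 * Real.sqrt x * ‖f x‖ ≤ x * C + x :=
    le_trans (mul_le_mul_of_nonneg_left h1 (by positivity)) (h2.trans h3)
  have h6 : ‖f x‖ ≤ (C + 1) / 2 * Real.sqrt x := by
    have : Real.sqrt x * (2 * ‖f x‖) ≤ Real.sqrt x * ((C + 1) * Real.sqrt x) := by nlinarith
    have := le_of_mul_le_mul_left this hs0
    linarith
  calc ‖f x‖ ^ 2 ≤ ((C + 1) / 2 * Real.sqrt x) ^ 2 := by gcongr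
    _ = _ := by rw [mul_pow, hs]

lemma dp_basic {f g : ℝ → ℂ} (h : InDP f g) :
    AEStronglyMeasurable (fun x => ‖f x‖ ^ 2) (volume.restrict (Ioi (0:ℝ))) ∧
    IntegrableOn (fun x => (Real.log x) ^ 2 * ‖f x‖ ^ 2) (Ioi 0) ∧
    IntegrableOn (fun x => ‖g x‖ ^ 2) (Ioi 0) ∧
    IntegrableOn (fun x => x * ‖g x‖ ^ 2) (Ioi 0) ∧
    IntegrableOn (fun x => ‖f x‖ ^ 2 / x ^ 2) (Ioi 0) ∧
    ∃ K, ∀ x > 0, ‖f x‖ ^ 2 ≤ K * x := by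
  obtain ⟨h1, h2, h3, h4, h5, h6, h7, h8, h9, h10, h11⟩ := h
  refine ⟨(h1.aestronglyMeasurable.restrict.norm.pow 2), ?_, ?_, ?_, ?_, _, f_bound h4 h8 le_rfl⟩
  · refine ((memLp_two_iff_integrable_sq_norm h11.aestronglyMeasurable).1 h11).congr
      (Eventually.of_forall fun x => ?_)
    simp only [norm_mul, Complex.norm_real, Real.norm_eq_abs, mul_pow, sq_abs]
  · exact (memLp_two_iff_integrable_sq_norm h8.aestronglyMeasurable).1 h8
  · refine ((memLp_two_iff_integrable_sq_norm h9.aestronglyMeasurable).1 h9).congr ?_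
    filter_upwards [ae_restrict_mem measurableSet_Ioi] with x hx
    simp only [norm_mul, Complex.norm_real, Real.norm_eq_abs, mul_pow, sq_abs]
    rw [Real.sq_sqrt (le_of_lt hx)]
  · refine ((memLp_two_iff_integrable_sq_norm h10.aestronglyMeasurable).1 h10).congr
      (Eventually.of_forall fun x => ?_)
    simp only [norm_div, Complex.norm_real, Real.norm_eq_abs, div_pow, sq_abs]

lemma dp_good {f g : ℝ → ℂ} (h : InDP f g) {w : ℝ → ℝ} (hw : GoodW w) :
    IntegrableOn (fun x => w x * ‖f x‖ ^ 2) (Ioi 0) := by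
  obtain ⟨hm, hl, -, -, -, K, hK⟩ := dp_basic h
  exact good_integrable hw hm (fun _ _ => sq_nonneg _) hK hl

lemma Wnorm_eq (f : ℝ → ℂ) : Wnorm f = ∫ x in Ioi (0:ℝ), 1 / x * ‖f x‖ ^ 2 := by
  unfold Wnorm
  congr 1; ext x; ring

lemma dp_W {f g : ℝ → ℂ} (h : InDP f g) : 1 ≤ Wnorm f := by
  have h1 := dp_good h good_one
  have h2 := dp_good h good_log
  have h3 := dp_good h good_inv
  have e1 : ∫ x in Ioi (0:ℝ), ‖f x‖ ^ 2 = 1 := h.2.2.2.2.1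
  have e2 : ∫ x in Ioi (0:ℝ), Real.log x * ‖f x‖ ^ 2 = 0 := h.2.2.2.2.2.2.1
  have e3 : ∫ x in Ioi (0:ℝ), (1 * ‖f x‖ ^ 2 - Real.log x * ‖f x‖ ^ 2) = 1 := by
    rw [integral_sub h1 h2]; simp only [one_mul]; rw [e1, e2]; norm_num
  rw [Wnorm_eq]
  refine e3.symm.le.trans ?_
  apply setIntegral_mono_on (h1.sub h2) h3 measurableSet_Ioi
  intro x hx
  have hx0 : 0 < x := hx
  have := Real.log_le_sub_one_of_pos (inv_pos.2 hx0)
  rw [Real.log_inv] at this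
  have h5 := sq_nonneg ‖f x‖
  simp only [Pi.sub_apply, one_div]
  nlinarith

lemma dp_B {f g : ℝ → ℂ} (h : InDP f g) :
    Wnorm f ^ 2 ≤ ∫ x in Ioi (0:ℝ), ‖f x‖ ^ 2 / x ^ 2 := by
  obtain ⟨-, -, -, -, hB, -⟩ := dp_basic h
  have h1 := dp_good h good_one
  have h3 := dp_good h good_inv
  have e1 : ∫ x in Ioi (0:ℝ), ‖f x‖ ^ 2 = 1 := h.2.2.2.2.1
  have e3 : ∫ x in Ioi (0:ℝ), (2 * Wnorm f * (1 / x * ‖f x‖ ^ 2) - Wnorm f ^ 2 * (1 * ‖f x‖ ^ 2))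
      = Wnorm f ^ 2 := by
    rw [integral_sub (h3.const_mul _) (h1.const_mul _), integral_const_mul, integral_const_mul,
      ← Wnorm_eq]
    simp only [one_mul]; rw [e1]; ring
  rw [← e3]
  apply integral_mono ((h3.const_mul _).sub (h1.const_mul _)) hB
  intro x
  have h5 : 0 ≤ (1 / x - Wnorm f) ^ 2 * ‖f x‖ ^ 2 := by positivity
  have h6 : ‖f x‖ ^ 2 / x ^ 2 = (1 / x) ^ 2 * ‖f x‖ ^ 2 := by rw [one_div, inv_pow]; ring
  simp only [h6, Pi.sub_apply]
  nlinarith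

lemma dp_V {f g : ℝ → ℂ} (h : InDP f g) : 0 ≤
    ((1 / Wnorm f) * (∫ ω in Set.Ioi (0:ℝ), (Real.log ω) ^ 2 * ‖f ω‖ ^ 2 / ω) -
    (1 / Wnorm f ^ 2) * (∫ ω in Set.Ioi (0:ℝ), Real.log ω * ‖f ω‖ ^ 2 / ω) ^ 2) := by
  have hW := dp_W h
  have h1 := dp_good h good_inv
  have h2 := dp_good h good_log_inv
  have h3 := dp_good h good_log2_inv
  have e2 : ∫ ω in Set.Ioi (0:ℝ), Real.log ω * ‖f ω‖ ^ 2 / ω = ∫ x in Ioi (0:ℝ), Real.log x / x * ‖f x‖ ^ 2 := by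
    congr 1; ext x; ring
  have e3 : ∫ ω in Set.Ioi (0:ℝ), Real.log ω ^ 2 * ‖f ω‖ ^ 2 / ω = ∫ x in Ioi (0:ℝ), Real.log x ^ 2 / x * ‖f x‖ ^ 2 := by
    congr 1; ext x; ring
  rw [e2, e3]
  set M1 := ∫ x in Ioi (0:ℝ), Real.log x / x * ‖f x‖ ^ 2
  set M2 := ∫ x in Ioi (0:ℝ), Real.log x ^ 2 / x * ‖f x‖ ^ 2
  set W := Wnorm f with hWd
  have key : 0 ≤ M2 - 2 * (M1 / W) * M1 + (M1 / W) ^ 2 * W := by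
    have e : ∫ x in Ioi (0:ℝ), (Real.log x ^ 2 / x * ‖f x‖ ^ 2 - 2 * (M1 / W) * (Real.log x / x * ‖f x‖ ^ 2)
        + (M1 / W) ^ 2 * (1 / x * ‖f x‖ ^ 2)) = M2 - 2 * (M1 / W) * M1 + (M1 / W) ^ 2 * W := by
      have h32 : IntegrableOn (fun x => Real.log x ^ 2 / x * ‖f x‖ ^ 2 - 2 * (M1 / W) * (Real.log x / x * ‖f x‖ ^ 2))
        (Ioi 0) := h3.sub (h2.const_mul _)
      rw [integral_add h32 (h1.const_mul _), integral_sub h3 (h2.const_mul _),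
        integral_const_mul, integral_const_mul, ← Wnorm_eq]
    rw [← e]
    apply setIntegral_nonneg measurableSet_Ioi
    intro x hx
    have hx0 : 0 < x := hx
    have : Real.log x ^ 2 / x * ‖f x‖ ^ 2 - 2 * (M1 / W) * (Real.log x / x * ‖f x‖ ^ 2)
        + (M1 / W) ^ 2 * (1 / x * ‖f x‖ ^ 2) = (Real.log x - M1 / W) ^ 2 * (1 / x) * ‖f x‖ ^ 2 := by ring
    rw [this]; positivity
  have hW0 : 0 < W := by linarith
  have : 1 / W * M2 - 1 / W ^ 2 * M1 ^ 2 = 1 / W * (M2 - 2 * (M1 / W) * M1 + (M1 / W) ^ 2 * W) := by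
    field_simp; ring
  rw [this]; positivity

lemma dp_LP {f g : ℝ → ℂ} (h : InDP f g) :
    (∫ ω in Set.Ioi (0:ℝ), ‖g ω‖ ^ 2) + (∫ ω in Set.Ioi (0:ℝ), (Real.log ω) ^ 2 * ‖f ω‖ ^ 2) +
    (∫ ω in Set.Ioi (0:ℝ), ω * ‖g ω‖ ^ 2) ≤ LP f g := by
  have hW := dp_W h
  have hB := dp_B h
  have hV := dp_V h
  have hA : 0 ≤ ∫ ω in Set.Ioi (0:ℝ), ω * ‖g ω‖ ^ 2 :=
    setIntegral_nonneg measurableSet_Ioi (fun x hx => mul_nonneg (le_of_lt hx) (sq_nonneg _))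
  unfold LP
  set A := ∫ ω in Set.Ioi (0:ℝ), ω * ‖g ω‖ ^ 2
  set B := ∫ ω in Set.Ioi (0:ℝ), ‖f ω‖ ^ 2 / ω ^ 2
  have : A ≤ 1 / Wnorm f * (A * B) := by
    rw [one_div, inv_mul_eq_div, le_div_iff₀ (by linarith)]
    apply mul_le_mul_of_nonneg_left _ hA
    nlinarith
  linarith

lemma weak_lsc {μ : Measure ℝ} (G : ℕ → ℝ → ℂ) (G₀ : ℝ → ℂ) (hG : ∀ n, MemLp (G n) 2 μ)
    (hG₀ : MemLp G₀ 2 μ) (v : ℝ → ℝ) (hvm : Measurable v) (hv : ∀ᵐ x ∂μ, 0 ≤ v x ∧ v x ≤ 1)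
    (hweak : ∀ h : ℝ → ℂ, MemLp h 2 μ →
      Tendsto (fun n => ∫ x, G n x * (starRingEnd ℂ) (h x) ∂μ) atTop
        (𝓝 (∫ x, G₀ x * (starRingEnd ℂ) (h x) ∂μ))) (L : ℝ)
    (hL : Tendsto (fun n => ∫ x, v x * ‖G n x‖ ^ 2 ∂μ) atTop (𝓝 L)) :
    ∫ x, v x * ‖G₀ x‖ ^ 2 ∂μ ≤ L := by
  have hvi : ∀ H : ℝ → ℂ, MemLp H 2 μ → Integrable (fun x => v x * ‖H x‖ ^ 2) μ := by
    intro H hH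
    have h1 := (memLp_two_iff_integrable_sq_norm hH.aestronglyMeasurable).1 hH
    refine Integrable.mono h1 (hvm.aestronglyMeasurable.mul h1.aestronglyMeasurable) ?_
    filter_upwards [hv] with x hx
    rw [norm_mul, Real.norm_of_nonneg hx.1]
    exact mul_le_of_le_one_left (norm_nonneg _) hx.2
  have hh : MemLp (fun x => (v x : ℂ) * G₀ x) 2 μ := by
    refine MemLp.of_le hG₀ ((Complex.measurable_ofReal.comp hvm).aestronglyMeasurable.mul
      hG₀.aestronglyMeasurable) ?_
    filter_upwards [hv] with x hx
    rw [norm_mul, Complex.norm_real, Real.norm_of_nonneg hx.1]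
    exact mul_le_of_le_one_left (norm_nonneg _) hx.2
  have h1 := (Complex.continuous_re.tendsto _).comp (hweak _ hh)
  have e0 : (∫ x, G₀ x * (starRingEnd ℂ) ((v x : ℂ) * G₀ x) ∂μ).re = ∫ x, v x * ‖G₀ x‖ ^ 2 ∂μ := by
    rw [← Complex.ofReal_re (∫ x, v x * ‖G₀ x‖ ^ 2 ∂μ), ← integral_complex_ofReal]
    congr 2; ext x
    rw [map_mul, Complex.conj_ofReal, mul_left_comm, Complex.mul_conj, Complex.normSq_eq_norm_sq]
    push_cast; rfl
  rw [e0] at h1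
  have h2 : ∀ n, 2 * (∫ x, G n x * (starRingEnd ℂ) ((v x : ℂ) * G₀ x) ∂μ).re ≤
      ∫ x, v x * ‖G n x‖ ^ 2 ∂μ + ∫ x, v x * ‖G₀ x‖ ^ 2 ∂μ := by
    intro n
    have hIntg : Integrable (fun x => G n x * (starRingEnd ℂ) ((v x : ℂ) * G₀ x)) μ :=
      MemLp.integrable_mul (p := 2) (q := 2) (hG n) hh.star
    have e := integral_re (𝕜 := ℂ) hIntg
    simp only [RCLike.re_to_complex] at e
    rw [← e, ← integral_const_mul, ← integral_add (hvi _ (hG n)) (hvi _ hG₀)]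
    apply integral_mono_ae (hIntg.re.const_mul 2) ((hvi _ (hG n)).add (hvi _ hG₀))
    filter_upwards [hv] with x hx
    simp only [Pi.add_apply]
    have h3 := Complex.re_le_norm (G n x * (starRingEnd ℂ) ((v x : ℂ) * G₀ x))
    rw [norm_mul, RCLike.norm_conj, norm_mul, Complex.norm_real, Real.norm_of_nonneg hx.1] at h3
    have h4 : 0 ≤ v x * (‖G n x‖ - ‖G₀ x‖) ^ 2 := mul_nonneg hx.1 (sq_nonneg _)
    change 2 * (G n x * (starRingEnd ℂ) ((v x : ℂ) * G₀ x)).re ≤ _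
    nlinarith
  have := le_of_tendsto_of_tendsto' (h1.const_mul 2) (hL.add_const _) h2
  linarith
lemma pair_tendsto {μ : Measure ℝ} (f g : ℕ → ℝ → ℂ) (f₀ g₀ : ℝ → ℂ) (hf : ∀ n, MemLp (f n) 2 μ)
    (hg : ∀ n, MemLp (g n) 2 μ) (hf₀ : MemLp f₀ 2 μ) (C : ℝ) (hC : ∀ n, ∫ x, ‖g n x‖ ^ 2 ∂μ ≤ C)
    (hd : Tendsto (fun n => ∫ x, ‖f n x - f₀ x‖ ^ 2 ∂μ) atTop (𝓝 0))
    (hw : Tendsto (fun n => ∫ x, g n x * (starRingEnd ℂ) (f₀ x) ∂μ) atTop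
        (𝓝 (∫ x, g₀ x * (starRingEnd ℂ) (f₀ x) ∂μ))) :
    Tendsto (fun n => ∫ x, g n x * (starRingEnd ℂ) (f n x) ∂μ) atTop
        (𝓝 (∫ x, g₀ x * (starRingEnd ℂ) (f₀ x) ∂μ)) := by
  have hdm : ∀ n, MemLp (fun x => f n x - f₀ x) 2 μ := fun n => (hf n).sub hf₀
  have hI : ∀ n, Integrable (fun x => g n x * (starRingEnd ℂ) (f₀ x)) μ := fun n =>
    MemLp.integrable_mul (p := 2) (q := 2) (hg n) hf₀.star
  have hJ : ∀ n, Integrable (fun x => g n x * (starRingEnd ℂ) (f n x - f₀ x)) μ := fun n =>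
    MemLp.integrable_mul (p := 2) (q := 2) (hg n) (hdm n).star
  have hgi : ∀ n, Integrable (fun x => ‖g n x‖ ^ 2) μ := fun n =>
    (memLp_two_iff_integrable_sq_norm (hg n).aestronglyMeasurable).1 (hg n)
  have hdi : ∀ n, Integrable (fun x => ‖f n x - f₀ x‖ ^ 2) μ := fun n =>
    (memLp_two_iff_integrable_sq_norm (hdm n).aestronglyMeasurable).1 (hdm n)
  have hC0 : 0 ≤ C := le_trans (integral_nonneg (fun _ => sq_nonneg _)) (hC 0)
  have h0 : Tendsto (fun n => ∫ x, g n x * (starRingEnd ℂ) (f n x - f₀ x) ∂μ) atTop (𝓝 0) := by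
    rw [Metric.tendsto_atTop] at hd ⊢
    intro ε hε
    set δ := ε / (C + 1) with hδ
    have hδ0 : 0 < δ := by positivity
    have hδC : δ * (C + 1) = ε := by rw [hδ]; field_simp
    obtain ⟨N, hN⟩ := hd (δ * ε) (by positivity)
    refine ⟨N, fun n hn => ?_⟩
    have h1 := hN n hn
    rw [Real.dist_eq, sub_zero, abs_of_nonneg (integral_nonneg (fun _ => sq_nonneg _))] at h1
    rw [dist_zero_right]
    have h2 : δ * ∫ x, ‖g n x * (starRingEnd ℂ) (f n x - f₀ x)‖ ∂μ ≤
        δ ^ 2 / 2 * ∫ x, ‖g n x‖ ^ 2 ∂μ + 1 / 2 * ∫ x, ‖f n x - f₀ x‖ ^ 2 ∂μ := by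
      rw [← integral_const_mul, ← integral_const_mul, ← integral_const_mul,
        ← integral_add ((hgi n).const_mul _) ((hdi n).const_mul _)]
      apply integral_mono ((hJ n).norm.const_mul _) (((hgi n).const_mul _).add ((hdi n).const_mul _))
      intro x
      simp only [Pi.add_apply, norm_mul, RCLike.norm_conj]
      nlinarith [sq_nonneg (δ * ‖g n x‖ - ‖f n x - f₀ x‖)]
    have h3 : δ ^ 2 / 2 * ∫ x, ‖g n x‖ ^ 2 ∂μ ≤ δ ^ 2 / 2 * C :=
      mul_le_mul_of_nonneg_left (hC n) (by positivity)
    have h4 : δ * ∫ x, ‖g n x * (starRingEnd ℂ) (f n x - f₀ x)‖ ∂μ < δ * ε := by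
      have : δ ^ 2 / 2 * C < δ * ε / 2 := by
        have : δ ^ 2 / 2 * C + δ ^ 2 / 2 = δ * ε / 2 := by rw [← hδC]; ring
        have : 0 < δ ^ 2 / 2 := by positivity
        linarith
      linarith
    exact (norm_integral_le_integral_norm _).trans_lt (lt_of_mul_lt_mul_left h4 hδ0.le)
  have := hw.add h0
  rw [add_zero] at this
  refine this.congr (fun n => ?_)
  rw [← integral_add (hI n) (hJ n)]
  congr 1; ext x
  rw [map_sub]; ring

lemma limit_lemma (f g : ℕ → ℝ → ℂ) (hdp : ∀ n, InDP (f n) (g n)) (m C : ℝ)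
    (hC : ∀ n, LP (f n) (g n) ≤ C) (hm : Tendsto (fun n => LP (f n) (g n)) atTop (𝓝 m))
    (G1 L A : ℝ) (hG1 : Tendsto (fun n => ∫ x in Ioi (0:ℝ), ‖g n x‖ ^ 2) atTop (𝓝 G1))
    (hL : Tendsto (fun n => ∫ x in Ioi (0:ℝ), Real.log x ^ 2 * ‖f n x‖ ^ 2) atTop (𝓝 L))
    (hA : Tendsto (fun n => ∫ x in Ioi (0:ℝ), x * ‖g n x‖ ^ 2) atTop (𝓝 A))
    (hGm : ∀ n, MemLp (fun x => (Real.sqrt (1 + x) : ℂ) * g n x) 2 (volume.restrict (Ioi (0:ℝ))))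
    (G₀ : ℝ → ℂ) (hG₀ : MemLp G₀ 2 (volume.restrict (Ioi (0:ℝ))))
    (hweak : ∀ h : ℝ → ℂ, MemLp h 2 (volume.restrict (Ioi (0:ℝ))) →
      Tendsto (fun n => ∫ x in Ioi (0:ℝ), ((Real.sqrt (1 + x) : ℂ) * g n x) * (starRingEnd ℂ) (h x)) atTop
        (𝓝 (∫ x in Ioi (0:ℝ), G₀ x * (starRingEnd ℂ) (h x)))) :
    ∃ f₀ g₀ : ℝ → ℂ, InDP f₀ g₀ ∧ LP f₀ g₀ ≤ m := by
  have hs1 : ∀ x : ℝ, 0 < x → 1 ≤ Real.sqrt (1 + x) := by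
    intro x hx
    rw [Real.one_le_sqrt]; linarith
  have hsm : Measurable (fun x : ℝ => (Real.sqrt (1 + x) : ℂ)) := by fun_prop
  let g₀ : ℝ → ℂ := (Ioi (0:ℝ)).indicator (fun x => G₀ x / (Real.sqrt (1 + x) : ℂ))
  have hg₀v : ∀ x : ℝ, 0 < x → g₀ x = G₀ x / (Real.sqrt (1 + x) : ℂ) := by
    intro x hx
    exact indicator_of_mem (s := Ioi (0:ℝ)) hx _
  have hg₀s : ∀ x : ℝ, 0 < x → G₀ x = (Real.sqrt (1 + x) : ℂ) * g₀ x := by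
    intro x hx
    have : (Real.sqrt (1 + x) : ℂ) ≠ 0 := by
      have := hs1 x hx
      exact_mod_cast (by linarith : Real.sqrt (1 + x) ≠ 0 |> fun _ => 0 < Real.sqrt (1 + x)).ne'
    rw [hg₀v x hx]; field_simp
  have hg₀z : ∀ x : ℝ, x ≤ 0 → g₀ x = 0 := by
    intro x hx
    exact indicator_of_notMem (by simpa using hx) _
  have hg₀m : AEStronglyMeasurable g₀ (volume.restrict (Ioi (0:ℝ))) := by
    refine AEStronglyMeasurable.indicator ?_ measurableSet_Ioi
    exact (hG₀.aestronglyMeasurable.aemeasurable.div hsm.aemeasurable).aestronglyMeasurable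
  have hg₀L : MemLp g₀ 2 (volume.restrict (Ioi (0:ℝ))) := by
    refine MemLp.of_le hG₀ hg₀m ?_
    filter_upwards [ae_restrict_mem measurableSet_Ioi] with x hx
    rw [hg₀s x hx, norm_mul, Complex.norm_real, Real.norm_of_nonneg (Real.sqrt_nonneg _)]
    exact le_mul_of_one_le_left (norm_nonneg _) (hs1 x hx)
  have hg₀xL : MemLp (fun x : ℝ => (Real.sqrt x : ℂ) * g₀ x) 2 (volume.restrict (Ioi (0:ℝ))) := by
    refine MemLp.of_le hG₀ ((by fun_prop : Measurable (fun x : ℝ => (Real.sqrt x : ℂ))).aestronglyMeasurable.mul hg₀m) ?_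
    filter_upwards [ae_restrict_mem measurableSet_Ioi] with x hx
    rw [hg₀s x hx, norm_mul, norm_mul, Complex.norm_real, Complex.norm_real,
      Real.norm_of_nonneg (Real.sqrt_nonneg _), Real.norm_of_nonneg (Real.sqrt_nonneg _)]
    exact mul_le_mul_of_nonneg_right (Real.sqrt_le_sqrt (by linarith)) (norm_nonneg _)
  -- weak convergence of `g n`
  have hweak' : ∀ h : ℝ → ℂ, MemLp h 2 (volume.restrict (Ioi (0:ℝ))) →
      Tendsto (fun n => ∫ x in Ioi (0:ℝ), g n x * (starRingEnd ℂ) (h x)) atTop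
        (𝓝 (∫ x in Ioi (0:ℝ), g₀ x * (starRingEnd ℂ) (h x))) := by
    intro h hh
    have hh' : MemLp (fun x => h x / (Real.sqrt (1 + x) : ℂ)) 2 (volume.restrict (Ioi (0:ℝ))) := by
      refine MemLp.of_le hh
        (hh.aestronglyMeasurable.aemeasurable.div hsm.aemeasurable).aestronglyMeasurable ?_
      filter_upwards [ae_restrict_mem measurableSet_Ioi] with x hx
      rw [norm_div, Complex.norm_real, Real.norm_of_nonneg (Real.sqrt_nonneg _)]
      exact div_le_self (norm_nonneg _) (hs1 x hx)
    have key : ∀ x ∈ Ioi (0:ℝ), ∀ z : ℂ, ((Real.sqrt (1 + x) : ℂ) * z) *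
        (starRingEnd ℂ) (h x / (Real.sqrt (1 + x) : ℂ)) = z * (starRingEnd ℂ) (h x) := by
      intro x hx z
      have h1 : (Real.sqrt (1 + x) : ℂ) ≠ 0 := by
        have := hs1 x hx
        have h2 : Real.sqrt (1 + x) ≠ 0 := by linarith
        exact_mod_cast h2
      rw [map_div₀, Complex.conj_ofReal]; field_simp
    have := hweak _ hh'
    have e0 : ∫ x in Ioi (0:ℝ), G₀ x * (starRingEnd ℂ) (h x / (Real.sqrt (1 + x) : ℂ)) =
        ∫ x in Ioi (0:ℝ), g₀ x * (starRingEnd ℂ) (h x) := by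
      apply setIntegral_congr_fun measurableSet_Ioi
      intro x hx
      simp only
      rw [hg₀s x hx]; exact key x hx _
    rw [e0] at this
    refine this.congr (fun n => ?_)
    apply setIntegral_congr_fun measurableSet_Ioi
    intro x hx
    exact key x hx _
  -- definition of the limit
  let f₀ : ℝ → ℂ := fun x => ∫ t in (0:ℝ)..x, g₀ t
  have hf₀z : ∀ x : ℝ, x ≤ 0 → f₀ x = 0 := by
    intro x hx
    simp only [f₀]
    rw [intervalIntegral.integral_symm, intervalIntegral.integral_of_le hx,
      setIntegral_congr_fun (g := fun _ => (0:ℂ)) measurableSet_Ioc (fun t ht => hg₀z t ht.2)]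
    simp
  have hg₀ii : ∀ x : ℝ, IntervalIntegrable g₀ volume 0 x := by
    intro x
    rcases le_total 0 x with hx | hx
    · rw [intervalIntegrable_iff_integrableOn_Ioc_of_le hx]
      have : MemLp g₀ 2 (volume.restrict (Ioc 0 x)) :=
        hg₀L.mono_measure (Measure.restrict_mono Ioc_subset_Ioi_self le_rfl)
      exact this.integrable (by norm_num)
    · apply IntervalIntegrable.symm
      rw [intervalIntegrable_iff_integrableOn_Ioc_of_le hx]
      refine IntegrableOn.congr_fun (f := fun _ => (0:ℂ)) integrableOn_zero
        (fun t ht => (hg₀z t ht.2).symm) measurableSet_Ioc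
  have hpt : ∀ x > 0, Tendsto (fun n => f n x) atTop (𝓝 (f₀ x)) := by
    intro x hx
    have hh : MemLp ((Ioc 0 x).indicator (fun _ => (1:ℂ))) 2 (volume.restrict (Ioi (0:ℝ))) := by
      refine (memLp_indicator_const 2 measurableSet_Ioc 1 (Or.inr ?_))
      rw [Measure.restrict_apply measurableSet_Ioc]
      exact ((measure_mono inter_subset_left).trans_lt measure_Ioc_lt_top).ne
    have key : ∀ q : ℝ → ℂ, ∫ t in Ioi (0:ℝ), q t * (starRingEnd ℂ) ((Ioc 0 x).indicator (fun _ => (1:ℂ)) t)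
        = ∫ t in (0:ℝ)..x, q t := by
      intro q
      have : ∀ t, q t * (starRingEnd ℂ) ((Ioc 0 x).indicator (fun _ => (1:ℂ)) t) = (Ioc 0 x).indicator q t := by
        intro t
        by_cases ht : t ∈ Ioc 0 x <;> simp [ht]
      simp_rw [this]
      rw [setIntegral_indicator measurableSet_Ioc, inter_eq_right.2 Ioc_subset_Ioi_self,
        intervalIntegral.integral_of_le hx.le]
    have := hweak' _ hh
    simp_rw [key] at this
    refine this.congr (fun n => ?_)
    exact ((hdp n).2.2.2.1 x).symm
  -- bounds
  have hgnn : ∀ n, 0 ≤ ∫ x in Ioi (0:ℝ), ‖g n x‖ ^ 2 := fun n => integral_nonneg (fun _ => sq_nonneg _)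
  have hLnn : ∀ n, 0 ≤ ∫ x in Ioi (0:ℝ), Real.log x ^ 2 * ‖f n x‖ ^ 2 := fun n =>
    integral_nonneg (fun _ => mul_nonneg (sq_nonneg _) (sq_nonneg _))
  have hAnn : ∀ n, 0 ≤ ∫ x in Ioi (0:ℝ), x * ‖g n x‖ ^ 2 := fun n =>
    setIntegral_nonneg measurableSet_Ioi (fun x hx => mul_nonneg (le_of_lt hx) (sq_nonneg _))
  have hgC : ∀ n, ∫ x in Ioi (0:ℝ), ‖g n x‖ ^ 2 ≤ C := fun n => by
    linarith [dp_LP (hdp n), hC n, hLnn n, hAnn n]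
  have hLC : ∀ n, ∫ x in Ioi (0:ℝ), Real.log x ^ 2 * ‖f n x‖ ^ 2 ≤ C := fun n => by
    linarith [dp_LP (hdp n), hC n, hgnn n, hAnn n]
  have hK : ∀ n, ∀ x > 0, ‖f n x‖ ^ 2 ≤ ((C + 1) / 2) ^ 2 * x := fun n =>
    f_bound (hdp n).2.2.2.1 (hdp n).2.2.2.2.2.2.2.1 (hgC n)
  have hupt : ∀ x > 0, Tendsto (fun n => ‖f n x‖ ^ 2) atTop (𝓝 (‖f₀ x‖ ^ 2)) := fun x hx =>
    ((hpt x hx).norm.pow 2)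
  have hK0 : ∀ x > 0, ‖f₀ x‖ ^ 2 ≤ ((C + 1) / 2) ^ 2 * x := fun x hx =>
    le_of_tendsto' (hupt x hx) (fun n => hK n x hx)
  have hfm : ∀ n, AEStronglyMeasurable (f n) (volume.restrict (Ioi (0:ℝ))) := fun n =>
    (hdp n).1.aestronglyMeasurable.restrict
  have hfm0 : AEStronglyMeasurable f₀ (volume.restrict (Ioi (0:ℝ))) := by
    refine aestronglyMeasurable_of_tendsto_ae atTop hfm ?_
    filter_upwards [ae_restrict_mem measurableSet_Ioi] with x hx using hpt x hx
  have hconv : ∀ w : ℝ → ℝ, GoodW w → Tendsto (fun n => ∫ x in Ioi 0, w x * ‖f n x‖ ^ 2) atTop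
      (𝓝 (∫ x in Ioi 0, w x * ‖f₀ x‖ ^ 2)) := fun w hw =>
    good_tendsto hw (fun n x => ‖f n x‖ ^ 2) (fun x => ‖f₀ x‖ ^ 2) (fun n => (dp_basic (hdp n)).1)
      (fun _ _ _ => sq_nonneg _) hK (fun n => (dp_basic (hdp n)).2.1) hLC hupt
  obtain ⟨hl0, hL0⟩ := fatou_real (μ := volume.restrict (Ioi 0)) (fun n x => (Real.log x) ^ 2 * ‖f n x‖ ^ 2)
    (fun x => (Real.log x) ^ 2 * ‖f₀ x‖ ^ 2) _ L (fun n => (dp_basic (hdp n)).2.1)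
    (fun n => Eventually.of_forall fun x => mul_nonneg (sq_nonneg _) (sq_nonneg _)) (by
      filter_upwards [ae_restrict_mem measurableSet_Ioi] with x hx using (hupt x hx).const_mul _)
    (fun n => le_rfl) hL
  have hgood0 : ∀ w : ℝ → ℝ, GoodW w → IntegrableOn (fun x => w x * ‖f₀ x‖ ^ 2) (Ioi 0) := fun w hw =>
    good_integrable hw (hfm0.norm.pow 2) (fun _ _ => sq_nonneg _) hK0 hl0
  have hf₀L : MemLp f₀ 2 (volume.restrict (Ioi (0:ℝ))) := by
    rw [memLp_two_iff_integrable_sq_norm hfm0]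
    have := hgood0 _ good_one
    simp only [one_mul] at this
    exact this
  have hf₀L' : MemLp f₀ 2 (volume : Measure ℝ) := by
    have e : f₀ = (Ioi (0:ℝ)).indicator f₀ := by
      ext x
      by_cases hx : x ∈ Ioi (0:ℝ)
      · rw [indicator_of_mem hx]
      · rw [indicator_of_notMem hx, hf₀z x (by simpa using hx)]
    rw [e, memLp_indicator_iff_restrict measurableSet_Ioi]
    exact hf₀L
  have hnorm : ∫ x in Ioi (0:ℝ), ‖f₀ x‖ ^ 2 = 1 := by
    have h1 := hconv _ good_one
    simp only [one_mul] at h1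
    have h2 : ∀ n, ∫ x in Ioi (0:ℝ), ‖f n x‖ ^ 2 = 1 := fun n => (hdp n).2.2.2.2.1
    simp_rw [h2] at h1
    exact tendsto_nhds_unique h1 tendsto_const_nhds
  have hlog : ∫ x in Ioi (0:ℝ), Real.log x * ‖f₀ x‖ ^ 2 = 0 := by
    have h1 := hconv _ good_log
    have h2 : ∀ n, ∫ x in Ioi (0:ℝ), Real.log x * ‖f n x‖ ^ 2 = 0 := fun n => (hdp n).2.2.2.2.2.2.1
    simp_rw [h2] at h1
    exact tendsto_nhds_unique h1 tendsto_const_nhds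
  -- strong convergence and the time constraint
  have htime : ∫ x in Ioi (0:ℝ), Complex.I * g₀ x * (starRingEnd ℂ) (f₀ x) = 0 := by
    have hle : ∀ a b : ℂ, ‖a - b‖ ^ 2 ≤ 2 * ‖a‖ ^ 2 + 2 * ‖b‖ ^ 2 := by
      intro a b
      have h1 := norm_sub_le a b
      have h2 := norm_nonneg (a - b)
      nlinarith [sq_nonneg (‖a‖ - ‖b‖)]
    have hdmeas : ∀ n, AEStronglyMeasurable (fun x => ‖f n x - f₀ x‖ ^ 2) (volume.restrict (Ioi (0:ℝ))) :=
      fun n => ((hfm n).sub hfm0).norm.pow 2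
    have hdom : ∀ n, IntegrableOn (fun x => 2 * (Real.log x ^ 2 * ‖f n x‖ ^ 2)
        + 2 * (Real.log x ^ 2 * ‖f₀ x‖ ^ 2)) (Ioi 0) := fun n =>
      ((dp_basic (hdp n)).2.1.const_mul 2).add (hl0.const_mul 2)
    have hptle : ∀ n x, Real.log x ^ 2 * ‖f n x - f₀ x‖ ^ 2 ≤ 2 * (Real.log x ^ 2 * ‖f n x‖ ^ 2)
        + 2 * (Real.log x ^ 2 * ‖f₀ x‖ ^ 2) := by
      intro n x
      have := mul_le_mul_of_nonneg_left (hle (f n x) (f₀ x)) (sq_nonneg (Real.log x))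
      linarith
    have hdlog : ∀ n, IntegrableOn (fun x => Real.log x ^ 2 * ‖f n x - f₀ x‖ ^ 2) (Ioi 0) := by
      intro n
      refine Integrable.mono' (hdom n)
        ((Real.measurable_log.pow_const 2).aestronglyMeasurable.mul (hdmeas n))
        (Eventually.of_forall fun x => ?_)
      rw [Real.norm_of_nonneg (by positivity)]
      exact hptle n x
    have hdz := good_tendsto_zero good_one (K := 4 * ((C + 1) / 2) ^ 2) (C := 2 * C + 2 * L)
      (fun n x => ‖f n x - f₀ x‖ ^ 2) hdmeas (fun _ _ _ => sq_nonneg _) (by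
        intro n x hx
        have h1 := hle (f n x) (f₀ x)
        have h2 := hK n x hx
        have h3 := hK0 x hx
        linarith) hdlog (by
        intro n
        calc ∫ x in Ioi 0, Real.log x ^ 2 * ‖f n x - f₀ x‖ ^ 2
            ≤ ∫ x in Ioi 0, (2 * (Real.log x ^ 2 * ‖f n x‖ ^ 2) + 2 * (Real.log x ^ 2 * ‖f₀ x‖ ^ 2)) :=
              integral_mono (hdlog n) (hdom n) (hptle n)
          _ = 2 * (∫ x in Ioi 0, Real.log x ^ 2 * ‖f n x‖ ^ 2) +
              2 * ∫ x in Ioi 0, Real.log x ^ 2 * ‖f₀ x‖ ^ 2 := by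
              rw [integral_add ((dp_basic (hdp n)).2.1.const_mul 2) (hl0.const_mul 2),
                integral_const_mul, integral_const_mul]
          _ ≤ 2 * C + 2 * L := by linarith [hLC n]) (by
        intro x hx
        have := ((hpt x hx).sub_const (f₀ x)).norm.pow 2
        simpa using this)
    simp only [abs_one, one_mul] at hdz
    have h1 := pair_tendsto f g f₀ g₀ (fun n => (hdp n).1.restrict _)
      (fun n => (hdp n).2.2.2.2.2.2.2.1) hf₀L C hgC hdz (hweak' _ hf₀L)
    have h2 : ∀ n, ∫ x in Ioi (0:ℝ), g n x * (starRingEnd ℂ) (f n x) = 0 := by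
      intro n
      have := (hdp n).2.2.2.2.2.1
      simp_rw [mul_assoc] at this
      rw [integral_const_mul] at this
      simpa using this
    simp_rw [h2] at h1
    have h3 := tendsto_nhds_unique h1 tendsto_const_nhds
    simp_rw [mul_assoc]
    rw [integral_const_mul, h3, mul_zero]
  -- lower semicontinuity
  have hvx : ∀ x ∈ Ioi (0:ℝ), ∀ z : ℂ, ‖(Real.sqrt (1 + x) : ℂ) * z‖ ^ 2 = (1 + x) * ‖z‖ ^ 2 := by
    intro x hx z
    have : (0:ℝ) ≤ 1 + x := by have : 0 < x := hx; linarith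
    rw [norm_mul, Complex.norm_real, mul_pow, Real.norm_eq_abs, sq_abs, Real.sq_sqrt this]
  have hlsc1 : ∫ x in Ioi (0:ℝ), ‖g₀ x‖ ^ 2 ≤ G1 := by
    have e : ∀ q : ℝ → ℂ, ∫ x in Ioi (0:ℝ), 1 / (1 + x) * ‖(Real.sqrt (1 + x) : ℂ) * q x‖ ^ 2 =
        ∫ x in Ioi (0:ℝ), ‖q x‖ ^ 2 := by
      intro q
      apply setIntegral_congr_fun measurableSet_Ioi
      intro x hx
      have : 0 < 1 + x := by have : 0 < x := hx; linarith
      simp only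
      rw [hvx x hx]; field_simp
    have := weak_lsc _ G₀ hGm hG₀ (fun x => 1 / (1 + x)) (by fun_prop) (by
      filter_upwards [ae_restrict_mem measurableSet_Ioi] with x hx
      have : 0 < x := hx
      refine ⟨by positivity, ?_⟩
      rw [div_le_one (by linarith)]; linarith) hweak G1 (by simp_rw [e]; exact hG1)
    refine le_trans (le_of_eq ?_) this
    rw [← e]
    apply setIntegral_congr_fun measurableSet_Ioi
    intro x hx
    simp only
    rw [hg₀s x hx]
  have hlscA : ∫ x in Ioi (0:ℝ), x * ‖g₀ x‖ ^ 2 ≤ A := by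
    have e : ∀ q : ℝ → ℂ, ∫ x in Ioi (0:ℝ), x / (1 + x) * ‖(Real.sqrt (1 + x) : ℂ) * q x‖ ^ 2 =
        ∫ x in Ioi (0:ℝ), x * ‖q x‖ ^ 2 := by
      intro q
      apply setIntegral_congr_fun measurableSet_Ioi
      intro x hx
      have : 0 < 1 + x := by have : 0 < x := hx; linarith
      simp only
      rw [hvx x hx]; field_simp
    have := weak_lsc _ G₀ hGm hG₀ (fun x => x / (1 + x)) (by fun_prop) (by
      filter_upwards [ae_restrict_mem measurableSet_Ioi] with x hx
      have : 0 < x := hx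
      refine ⟨by positivity, ?_⟩
      rw [div_le_one (by linarith)]; linarith) hweak A (by simp_rw [e]; exact hA)
    refine le_trans (le_of_eq ?_) this
    rw [← e]
    apply setIntegral_congr_fun measurableSet_Ioi
    intro x hx
    simp only
    rw [hg₀s x hx]
  have hxgi : IntegrableOn (fun x => x * ‖g₀ x‖ ^ 2) (Ioi 0) := by
    refine ((memLp_two_iff_integrable_sq_norm hg₀xL.aestronglyMeasurable).1 hg₀xL).congr ?_
    filter_upwards [ae_restrict_mem measurableSet_Ioi] with x hx
    simp only [norm_mul, Complex.norm_real, Real.norm_eq_abs, mul_pow, sq_abs]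
    rw [Real.sq_sqrt (le_of_lt hx)]
  have hA0nn : 0 ≤ ∫ x in Ioi (0:ℝ), x * ‖g₀ x‖ ^ 2 :=
    setIntegral_nonneg measurableSet_Ioi (fun x hx => mul_nonneg (le_of_lt hx) (sq_nonneg _))
  have hA0 : 0 < ∫ x in Ioi (0:ℝ), x * ‖g₀ x‖ ^ 2 := by
    refine lt_of_le_of_ne hA0nn (fun h0 => ?_)
    have h1 := (setIntegral_eq_zero_iff_of_nonneg_ae (by
      filter_upwards [ae_restrict_mem measurableSet_Ioi] with x hx
      exact mul_nonneg (le_of_lt hx) (sq_nonneg _)) hxgi).1 h0.symm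
    have h2 : ∀ᵐ x ∂(volume.restrict (Ioi (0:ℝ))), g₀ x = 0 := by
      filter_upwards [h1, ae_restrict_mem measurableSet_Ioi] with x hx hx0
      have : x ≠ 0 := ne_of_gt hx0
      simpa [this] using hx
    have h3 : ∀ x > 0, f₀ x = 0 := by
      intro x hx
      simp only [f₀]
      rw [intervalIntegral.integral_of_le hx.le]
      apply integral_eq_zero_of_ae
      exact ae_mono (Measure.restrict_mono Ioc_subset_Ioi_self le_rfl) h2
    have h4 : ∫ x in Ioi (0:ℝ), ‖f₀ x‖ ^ 2 = ∫ x in Ioi (0:ℝ), (0:ℝ) := by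
      apply setIntegral_congr_fun measurableSet_Ioi
      intro x hx
      simp [h3 x hx]
    rw [hnorm] at h4
    simp at h4
  -- convergence of the remaining quantities
  have hW : Tendsto (fun n => Wnorm (f n)) atTop (𝓝 (Wnorm f₀)) := by
    simp_rw [Wnorm_eq]; exact hconv _ good_inv
  have hW1 : 1 ≤ Wnorm f₀ := ge_of_tendsto' hW (fun n => dp_W (hdp n))
  have hW0 : Wnorm f₀ ≠ 0 := by linarith
  have eM1 : ∀ q : ℝ → ℂ, ∫ ω in Set.Ioi (0:ℝ), Real.log ω * ‖q ω‖ ^ 2 / ω =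
      ∫ x in Ioi (0:ℝ), Real.log x / x * ‖q x‖ ^ 2 := by
    intro q; congr 1; ext x; ring
  have eM2 : ∀ q : ℝ → ℂ, ∫ ω in Set.Ioi (0:ℝ), Real.log ω ^ 2 * ‖q ω‖ ^ 2 / ω =
      ∫ x in Ioi (0:ℝ), Real.log x ^ 2 / x * ‖q x‖ ^ 2 := by
    intro q; congr 1; ext x; ring
  have hM1 : Tendsto (fun n => ∫ ω in Set.Ioi (0:ℝ), Real.log ω * ‖f n ω‖ ^ 2 / ω) atTop
      (𝓝 (∫ ω in Set.Ioi (0:ℝ), Real.log ω * ‖f₀ ω‖ ^ 2 / ω)) := by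
    simp_rw [eM1]; exact hconv _ good_log_inv
  have hM2 : Tendsto (fun n => ∫ ω in Set.Ioi (0:ℝ), Real.log ω ^ 2 * ‖f n ω‖ ^ 2 / ω) atTop
      (𝓝 (∫ ω in Set.Ioi (0:ℝ), Real.log ω ^ 2 * ‖f₀ ω‖ ^ 2 / ω)) := by
    simp_rw [eM2]; exact hconv _ good_log2_inv
  have hV : Tendsto (fun n => (1 / Wnorm (f n)) * (∫ ω in Set.Ioi (0:ℝ), (Real.log ω) ^ 2 * ‖f n ω‖ ^ 2 / ω) -
      (1 / Wnorm (f n) ^ 2) * (∫ ω in Set.Ioi (0:ℝ), Real.log ω * ‖f n ω‖ ^ 2 / ω) ^ 2) atTop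
      (𝓝 ((1 / Wnorm f₀) * (∫ ω in Set.Ioi (0:ℝ), (Real.log ω) ^ 2 * ‖f₀ ω‖ ^ 2 / ω) -
      (1 / Wnorm f₀ ^ 2) * (∫ ω in Set.Ioi (0:ℝ), Real.log ω * ‖f₀ ω‖ ^ 2 / ω) ^ 2)) :=
    ((tendsto_const_nhds.div hW hW0).mul hM2).sub
      ((tendsto_const_nhds.div (hW.pow 2) (pow_ne_zero 2 hW0)).mul (hM1.pow 2))
  set V0 := (1 / Wnorm f₀) * (∫ ω in Set.Ioi (0:ℝ), (Real.log ω) ^ 2 * ‖f₀ ω‖ ^ 2 / ω) -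
      (1 / Wnorm f₀ ^ 2) * (∫ ω in Set.Ioi (0:ℝ), Real.log ω * ‖f₀ ω‖ ^ 2 / ω) ^ 2 with hV0
  have hP : Tendsto (fun n => (1 / Wnorm (f n)) * ((∫ ω in Set.Ioi (0:ℝ), ω * ‖g n ω‖ ^ 2) *
    (∫ ω in Set.Ioi (0:ℝ), ‖f n ω‖ ^ 2 / ω ^ 2))) atTop (𝓝 (m - G1 - L - V0)) := by
    refine (((hm.sub hG1).sub hL).sub hV).congr (fun n => ?_)
    unfold LP; ring
  have hApos : 0 < A := hA0.trans_le hlscA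
  have hB : Tendsto (fun n => ∫ ω in Set.Ioi (0:ℝ), ‖f n ω‖ ^ 2 / ω ^ 2) atTop
      (𝓝 ((m - G1 - L - V0) * Wnorm f₀ / A)) := by
    refine ((hP.mul hW).div hA hApos.ne').congr' ?_
    filter_upwards [hA.eventually (lt_mem_nhds hApos)] with n hn
    have hWn : Wnorm (f n) ≠ 0 := by linarith [dp_W (hdp n)]
    have := hn.ne'
    simp only [Pi.div_apply, Pi.mul_apply]
    field_simp
  obtain ⟨hBi, hB0⟩ := fatou_real (μ := volume.restrict (Ioi 0)) (fun n x => ‖f n x‖ ^ 2 / x ^ 2)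
    (fun x => ‖f₀ x‖ ^ 2 / x ^ 2) _ _ (fun n => (dp_basic (hdp n)).2.2.2.2.1)
    (fun n => Eventually.of_forall fun x => by positivity) (by
      filter_upwards [ae_restrict_mem measurableSet_Ioi] with x hx using (hupt x hx).div_const _)
    (fun n => le_rfl) hB
  refine ⟨f₀, g₀, ⟨hf₀L', hf₀z, hg₀ii, fun x => rfl, hnorm, htime, hlog, hg₀L, hg₀xL, ?_, ?_⟩, ?_⟩
  · rw [memLp_two_iff_integrable_sq_norm]
    · refine hBi.congr (Eventually.of_forall fun x => ?_)
      simp only [norm_div, Complex.norm_real, Real.norm_eq_abs, div_pow, sq_abs]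
    · exact (hfm0.aemeasurable.div Complex.measurable_ofReal.aemeasurable).aestronglyMeasurable
  · rw [memLp_two_iff_integrable_sq_norm]
    · refine hl0.congr (Eventually.of_forall fun x => ?_)
      simp only [norm_mul, Complex.norm_real, Real.norm_eq_abs, mul_pow, sq_abs]
    · exact (Complex.measurable_ofReal.comp Real.measurable_log).aestronglyMeasurable.mul hfm0
  · have hB0nn : 0 ≤ ∫ x in Ioi (0:ℝ), ‖f₀ x‖ ^ 2 / x ^ 2 := integral_nonneg (fun x => by positivity)
    have h1 : (∫ x in Ioi (0:ℝ), x * ‖g₀ x‖ ^ 2) * (∫ x in Ioi (0:ℝ), ‖f₀ x‖ ^ 2 / x ^ 2) ≤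
        A * ((m - G1 - L - V0) * Wnorm f₀ / A) := mul_le_mul hlscA hB0 hB0nn hApos.le
    have h2 : 1 / Wnorm f₀ * ((∫ x in Ioi (0:ℝ), x * ‖g₀ x‖ ^ 2) * (∫ x in Ioi (0:ℝ), ‖f₀ x‖ ^ 2 / x ^ 2)) ≤
        1 / Wnorm f₀ * (A * ((m - G1 - L - V0) * Wnorm f₀ / A)) :=
      mul_le_mul_of_nonneg_left h1 (by positivity)
    have h3 : 1 / Wnorm f₀ * (A * ((m - G1 - L - V0) * Wnorm f₀ / A)) = m - G1 - L - V0 := by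
      have := hApos.ne'
      field_simp
    rw [h3] at h2
    unfold LP
    rw [← hV0]
    linarith
lemma LP_seq_min : ∃ f₀ g₀ : ℝ → ℂ, InDP f₀ g₀ ∧ ∀ f g : ℝ → ℂ, InDP f g → LP f₀ g₀ ≤ LP f g := by
  let S : Set ℝ := {r | ∃ f g : ℝ → ℂ, InDP f g ∧ LP f g = r}
  have hSne : S.Nonempty := by
    obtain ⟨f, g, h⟩ := exists_InDP
    exact ⟨_, f, g, h, rfl⟩
  have hnn : ∀ f g : ℝ → ℂ, InDP f g → 0 ≤ (∫ x in Ioi (0:ℝ), ‖g x‖ ^ 2) ∧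
      0 ≤ (∫ x in Ioi (0:ℝ), Real.log x ^ 2 * ‖f x‖ ^ 2) ∧ 0 ≤ ∫ x in Ioi (0:ℝ), x * ‖g x‖ ^ 2 := by
    intro f g _
    exact ⟨integral_nonneg (fun _ => sq_nonneg _),
      integral_nonneg (fun _ => mul_nonneg (sq_nonneg _) (sq_nonneg _)),
      setIntegral_nonneg measurableSet_Ioi (fun x hx => mul_nonneg (le_of_lt hx) (sq_nonneg _))⟩
  have hSb : BddBelow S := by
    refine ⟨0, ?_⟩
    rintro _ ⟨f, g, h, rfl⟩
    obtain ⟨h1, h2, h3⟩ := hnn f g h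
    linarith [dp_LP h]
  obtain ⟨r, -, hr, hrS⟩ := exists_seq_tendsto_sInf hSne hSb
  choose f g hdp hLP using hrS
  obtain ⟨C, hC⟩ := hr.bddAbove_range
  have hrC : ∀ n, LP (f n) (g n) ≤ C := fun n => by rw [hLP]; exact hC (mem_range_self n)
  have hb : ∀ n, ((∫ x in Ioi (0:ℝ), ‖g n x‖ ^ 2, ∫ x in Ioi (0:ℝ), Real.log x ^ 2 * ‖f n x‖ ^ 2,
      ∫ x in Ioi (0:ℝ), x * ‖g n x‖ ^ 2) : ℝ × ℝ × ℝ) ∈ Icc (0:ℝ) C ×ˢ (Icc (0:ℝ) C ×ˢ Icc (0:ℝ) C) := by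
    intro n
    obtain ⟨h1, h2, h3⟩ := hnn _ _ (hdp n)
    have := dp_LP (hdp n)
    have := hrC n
    refine ⟨⟨h1, ?_⟩, ⟨h2, ?_⟩, h3, ?_⟩ <;> simp only <;> linarith
  obtain ⟨⟨G1, L, A⟩, -, φ, hφ, hlim⟩ :=
    (isCompact_Icc.prod (isCompact_Icc.prod isCompact_Icc)).tendsto_subseq hb
  have hl1 := (continuous_fst.tendsto _).comp hlim
  have hl2 := ((continuous_fst.comp continuous_snd).tendsto _).comp hlim
  have hl3 := ((continuous_snd.comp continuous_snd).tendsto _).comp hlim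
  have hGm : ∀ n, MemLp (fun x => (Real.sqrt (1 + x) : ℂ) * g (φ n) x) 2 (volume.restrict (Ioi (0:ℝ))) ∧
      ∫ x in Ioi (0:ℝ), ‖(Real.sqrt (1 + x) : ℂ) * g (φ n) x‖ ^ 2 ≤ C := by
    intro n
    obtain ⟨-, -, i1, i2, -⟩ := dp_basic (hdp (φ n))
    have hm : AEStronglyMeasurable (fun x => (Real.sqrt (1 + x) : ℂ) * g (φ n) x) (volume.restrict (Ioi (0:ℝ))) :=
      (by fun_prop : Measurable (fun x : ℝ => (Real.sqrt (1 + x) : ℂ))).aestronglyMeasurable.mul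
        (hdp (φ n)).2.2.2.2.2.2.2.1.aestronglyMeasurable
    have e : ∀ x ∈ Ioi (0:ℝ), ‖(Real.sqrt (1 + x) : ℂ) * g (φ n) x‖ ^ 2 = ‖g (φ n) x‖ ^ 2 + x * ‖g (φ n) x‖ ^ 2 := by
      intro x hx
      have : (0:ℝ) ≤ 1 + x := by have : 0 < x := hx; linarith
      rw [norm_mul, Complex.norm_real, mul_pow, Real.norm_eq_abs, sq_abs, Real.sq_sqrt this]
      ring
    refine ⟨?_, ?_⟩
    · rw [memLp_two_iff_integrable_sq_norm hm]
      refine (i1.add i2).congr ?_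
      filter_upwards [ae_restrict_mem measurableSet_Ioi] with x hx
      exact (e x hx).symm
    · rw [setIntegral_congr_fun measurableSet_Ioi e, integral_add i1 i2]
      obtain ⟨h1, h2, h3⟩ := hnn _ _ (hdp (φ n))
      linarith [dp_LP (hdp (φ n)), hrC (φ n)]
  obtain ⟨G₀, hG₀, ψ, hψ, hw⟩ := weak_subseq (volume.restrict (Ioi (0:ℝ)))
    (fun n x => (Real.sqrt (1 + x) : ℂ) * g (φ n) x) (fun n => (hGm n).1) C (fun n => (hGm n).2)
  have hψt := hψ.tendsto_atTop
  obtain ⟨f₀, g₀, h0, hle⟩ := limit_lemma (fun n => f (φ (ψ n))) (fun n => g (φ (ψ n)))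
    (fun n => hdp _) (sInf S) C (fun n => hrC _) (by
      simp_rw [hLP]
      exact hr.comp (hφ.tendsto_atTop.comp hψt)) G1 L A (hl1.comp hψt) (hl2.comp hψt) (hl3.comp hψt)
    (fun n => (hGm _).1) G₀ hG₀ hw
  refine ⟨f₀, g₀, h0, fun f g h => hle.trans (csInf_le hSb ⟨f, g, h, rfl⟩)⟩


/-- There exists a minimizer of the phase space uncertainty `L_P` over `D_P`. -/
theorem exists_minimizer_LP :
    ∃ f₀ g₀ : ℝ → ℂ, InDP f₀ g₀ ∧ ∀ f g : ℝ → ℂ, InDP f g → LP f₀ g₀ ≤ LP f g := by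
  exact LP_seq_min
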